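/- Consider a uniformly random perfect matching of the 2n points {1, 2, …, 2n} into n pairs, each pair forming an interval [min, max]. The probability that some interval intersects all of the other n − 1 intervals equals exactly 2/3, for every n ≥ 2. -/

import Mathlib

open Finset
open scoped Classical

/-- The perfect matchings of `{1, …, 2n}`, encoded as fixed-point-free
involutions of `Fin (2n)`. -/
noncomputable def matchings (n : ℕ) : Finset (Equiv.Perm (Fin (2*n))) :=
  Finset.univ.filter (fun m => (∀ i, m (m i) = i) ∧ ∀ i, m i ≠ i)

/-- A matching has an interval meeting all others if some pair's interval
`[min i (m i), max i (m i)]` intersects every other pair's interval. -/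
def meetsAll {n : ℕ} (m : Equiv.Perm (Fin (2*n))) : Prop :=
  ∃ i : Fin (2*n), ∀ j : Fin (2*n),
    (Set.Icc (min i (m i)) (max i (m i)) ∩
      Set.Icc (min j (m j)) (max j (m j))).Nonempty

lemma mem_matchings_iff {n : ℕ} (m : Equiv.Perm (Fin (2*n))) :
    m ∈ matchings n ↔ (∀ i, m (m i) = i) ∧ ∀ i, m i ≠ i := by
  simp [matchings]

lemma meets_iff {n : ℕ} (m : Equiv.Perm (Fin (2*n))) (i j : Fin (2*n)) :
    (Set.Icc (min i (m i)) (max i (m i)) ∩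
      Set.Icc (min j (m j)) (max j (m j))).Nonempty ↔
    min i (m i) ≤ max j (m j) ∧ min j (m j) ≤ max i (m i) := by
  rw [Set.Icc_inter_Icc, Set.nonempty_Icc, sup_le_iff, le_inf_iff, le_inf_iff]
  have h1 : min i (m i) ≤ max i (m i) := min_le_max
  have h2 : min j (m j) ≤ max j (m j) := min_le_max
  tauto

/-- Matchings which agree with `m0` outside the unrevealed points `L ∪ R`. -/
noncomputable def Cls {n : ℕ} (m0 : Equiv.Perm (Fin (2*n))) (L R : Finset (Fin (2*n))) :
    Finset (Equiv.Perm (Fin (2*n))) :=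
  (matchings n).filter (fun m => ∀ i, i ∉ L → i ∉ R → m i = m0 i)

lemma mem_Cls {n : ℕ} (m0 m : Equiv.Perm (Fin (2*n))) (L R : Finset (Fin (2*n))) :
    m ∈ Cls m0 L R ↔ ((∀ i, m (m i) = i) ∧ ∀ i, m i ≠ i) ∧
      ∀ i, i ∉ L → i ∉ R → m i = m0 i := by
  simp [Cls, mem_matchings_iff]

/-- The revealed points are closed under the matching. -/
def Closed {n : ℕ} (m0 : Equiv.Perm (Fin (2*n))) (L R : Finset (Fin (2*n))) : Prop :=
  ∀ i, i ∉ L → i ∉ R → m0 i ∉ L ∧ m0 i ∉ R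

def Bal {n : ℕ} (m0 : Equiv.Perm (Fin (2*n))) (L R : Finset (Fin (2*n))) : Prop :=
  L.card = R.card ∧ ∀ j, j ∉ L → j ∉ R →
    ∃ x, (x = j ∨ x = m0 j) ∧ (∀ l ∈ L, l < x) ∧ (∀ r ∈ R, x < r)

def Imb {n : ℕ} (m0 : Equiv.Perm (Fin (2*n))) (L R : Finset (Fin (2*n))) : Prop :=
  R.card = L.card + 2 ∧ ∃ p, p ∉ L ∧ p ∉ R ∧ m0 p < p ∧ ∀ j, j ∉ L → j ∉ R →
    ∃ x, (x = j ∨ x = m0 j) ∧ (∀ l ∈ L, l < x) ∧ (∀ r ∈ R, x < r) ∧ p ≤ x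

def StateInv {n : ℕ} (m0 : Equiv.Perm (Fin (2*n))) (L R : Finset (Fin (2*n))) : Prop :=
  (∀ l ∈ L, ∀ r ∈ R, l < r) ∧ Closed m0 L R ∧ (Bal m0 L R ∨ Imb m0 L R)

def Third {n : ℕ} (s : Finset (Equiv.Perm (Fin (2*n)))) : Prop :=
  3 * (s.filter (fun m => ¬ meetsAll m)).card = s.card

lemma mem_of_Cls {n : ℕ} {m0 m : Equiv.Perm (Fin (2*n))} {L R : Finset (Fin (2*n))}
    (hc : Closed m0 L R) (hm : m ∈ Cls m0 L R) (a : Fin (2*n)) (ha : a ∈ L ∨ a ∈ R) :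
    m a ∈ L ∨ m a ∈ R := by
  rw [mem_Cls] at hm
  by_contra h
  push Not at h
  have h1 := hm.2 _ h.1 h.2
  rw [hm.1.1] at h1
  have h2 := hc _ h.1 h.2
  rw [← h1] at h2
  tauto

lemma fiber_eq {n : ℕ} {m0 m1 : Equiv.Perm (Fin (2*n))} {L R : Finset (Fin (2*n))}
    (a b : Fin (2*n)) (hm : m1 ∈ Cls m0 L R) (hb : m1 a = b) :
    (Cls m0 L R).filter (fun m => m a = b) =
      Cls m1 ((L.erase a).erase b) ((R.erase a).erase b) := by
  rw [mem_Cls] at hm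
  ext m
  simp only [mem_filter, mem_Cls, mem_erase]
  constructor
  · rintro ⟨⟨h1, h2⟩, h3⟩
    refine ⟨h1, fun i hi hi' => ?_⟩
    by_cases e1 : i = a
    · subst e1; rw [h3, hb]
    by_cases e2 : i = b
    · subst e2
      rw [← h3, h1.1, h3, ← hb, hm.1.1]
    rw [h2 i (by tauto) (by tauto), hm.2 i (by tauto) (by tauto)]
  · rintro ⟨h1, h2⟩
    have hab : m a = b := by rw [h2 a (by tauto) (by tauto), hb]
    refine ⟨⟨h1, fun i hi hi' => ?_⟩, hab⟩
    rw [h2 i (by tauto) (by tauto), hm.2 i hi hi']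

lemma third_step {n : ℕ} {m0 : Equiv.Perm (Fin (2*n))} {L R : Finset (Fin (2*n))}
    (hc : Closed m0 L R) (a : Fin (2*n)) (ha : a ∈ L ∨ a ∈ R)
    (H : ∀ m1 ∈ Cls m0 L R, ∀ b, b ≠ a → (b ∈ L ∨ b ∈ R) → m1 a = b →
      Third (Cls m1 ((L.erase a).erase b) ((R.erase a).erase b))) :
    Third (Cls m0 L R) := by
  have key : ∀ b, Third ((Cls m0 L R).filter (fun m => m a = b)) := by
    intro b
    by_cases h : ∃ m1 ∈ Cls m0 L R, m1 a = b
    · obtain ⟨m1, hm, hb⟩ := h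
      rw [fiber_eq a b hm hb]
      refine H m1 hm b ?_ ?_ hb
      · rw [← hb]; exact ((mem_Cls _ _ _ _).1 hm).1.2 a
      · rw [← hb]; exact mem_of_Cls hc hm a ha
    · push Not at h
      rw [Finset.filter_eq_empty_iff.2 (fun m hm => h m hm)]
      simp [Third]
  unfold Third at *
  rw [card_eq_sum_card_fiberwise (f := fun m => m a) (t := univ) (s := Cls m0 L R) (by simp),
    card_eq_sum_card_fiberwise (f := fun m => m a) (t := univ)
      (s := (Cls m0 L R).filter _) (by simp), mul_sum]
  refine sum_congr rfl (fun b _ => ?_)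
  rw [← key b, filter_filter, filter_filter]
  simp only [and_comm]

/-- Swapping two unrevealed points. -/
lemma fiber_swap {n : ℕ} {m0 : Equiv.Perm (Fin (2*n))} {L R : Finset (Fin (2*n))}
    (hc : Closed m0 L R)
    (a b c : Fin (2*n)) (hab : a ≠ b) (hac : a ≠ c) (hb : b ∈ L ∨ b ∈ R) (hc' : c ∈ L ∨ c ∈ R) :
    ((Cls m0 L R).filter (fun m => m a = b)).card ≤
      ((Cls m0 L R).filter (fun m => m a = c)).card := by
  refine card_le_card_of_injOn (fun m => Equiv.swap b c * m * Equiv.swap b c) ?_ ?_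
  · intro m hm
    simp only [coe_filter, Set.mem_ofPred_eq, mem_Cls] at hm ⊢
    obtain ⟨⟨⟨h1, h2⟩, h3⟩, h4⟩ := hm
    refine ⟨⟨⟨?_, ?_⟩, ?_⟩, ?_⟩
    · intro i; simp [h1]
    · intro i h
      simp only [Equiv.Perm.mul_apply] at h
      apply h2 (Equiv.swap b c i)
      have := congrArg (Equiv.swap b c) h
      simpa using this
    · intro i hi hi'
      have := hc i hi hi'
      have e : Equiv.swap b c i = i :=
        Equiv.swap_apply_of_ne_of_ne (by rintro rfl; tauto) (by rintro rfl; tauto)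
      simp only [Equiv.Perm.mul_apply]
      rw [e, h3 i hi hi']
      exact Equiv.swap_apply_of_ne_of_ne (by intro h; rw [h] at this; tauto)
        (by intro h; rw [h] at this; tauto)
    · simp [Equiv.swap_apply_of_ne_of_ne hab hac, h4]
  · intro m _ m' _ h
    simpa using h

lemma third_base {n : ℕ} {m0 : Equiv.Perm (Fin (2*n))} {L R : Finset (Fin (2*n))}
    (hc : Closed m0 L R) (a b c d : Fin (2*n)) (hab : a < b) (hbc : b < c) (hcd : c < d)
    (hS : ∀ i, (i ∈ L ∨ i ∈ R) ↔ (i = a ∨ i = b ∨ i = c ∨ i = d))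
    (h1 : ∀ j, j ∉ L → j ∉ R → ∃ x, (x = j ∨ x = m0 j) ∧ a < x ∧ x < c ∧
      (b < x ∨ ∃ p, p ∉ L ∧ p ∉ R ∧ m0 p < p ∧ p ≤ x)) :
    Third (Cls m0 L R) := by
  have hbad : ∀ m ∈ Cls m0 L R, (¬ meetsAll m ↔ m a = b) := by
    intro m hm
    have ham := mem_of_Cls hc hm a (by rw [hS]; tauto)
    have hbm := mem_of_Cls hc hm b (by rw [hS]; tauto)
    have hcm := mem_of_Cls hc hm c (by rw [hS]; tauto)
    have hdm := mem_of_Cls hc hm d (by rw [hS]; tauto)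
    rw [mem_Cls] at hm
    obtain ⟨⟨hi, hf⟩, he⟩ := hm
    rw [hS] at ham hbm hcm hdm
    unfold meetsAll
    simp only [meets_iff]
    have fa := hf a
    have fb := hf b
    have fc := hf c
    have fd := hf d
    have ia := hi a
    have ib := hi b
    have ic := hi c
    have id := hi d
    constructor
    · intro h
      by_contra hne
      apply h
      have hca : c ≤ m a := by grind
      refine ⟨a, fun j => ?_⟩
      by_cases hj : j ∈ L ∨ j ∈ R
      · rw [hS] at hj
        rcases hj with rfl | rfl | rfl | rfl <;> grind
      · push Not at hj
        obtain ⟨x, hx, hax, hxc, -⟩ := h1 j hj.1 hj.2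
        rw [← he j hj.1 hj.2] at hx
        grind
    · rintro hmab ⟨i, h⟩
      have hmcd : m c = d := by grind
      have hmba : m b = a := by grind
      have hmdc : m d = c := by grind
      have ha := h a
      have hc := h c
      rw [hmab] at ha
      rw [hmcd] at hc
      by_cases hj : i ∈ L ∨ i ∈ R
      · rw [hS] at hj
        rcases hj with rfl | rfl | rfl | rfl <;> grind
      · push Not at hj
        obtain ⟨x, hx, hax, hxc, hp⟩ := h1 i hj.1 hj.2
        rw [← he i hj.1 hj.2] at hx
        have hfi := hf i
        have hii := hi i
        rcases hp with hp | ⟨p, hpL, hpR, hpp, hpx⟩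
        · grind
        · have hp := h p
          rw [← he p hpL hpR] at hpp
          have := hi p
          grind
  have e1 : (Cls m0 L R).filter (fun m => ¬ meetsAll m) =
      (Cls m0 L R).filter (fun m => m a = b) := filter_congr hbad
  have hbS : b ∈ L ∨ b ∈ R := by rw [hS]; tauto
  have hcS : c ∈ L ∨ c ∈ R := by rw [hS]; tauto
  have hdS : d ∈ L ∨ d ∈ R := by rw [hS]; tauto
  have hac := hab.trans hbc
  have had := hac.trans hcd
  have s1 := le_antisymm (fiber_swap hc a b c hab.ne hac.ne hbS hcS)
    (fiber_swap hc a c b hac.ne hab.ne hcS hbS)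
  have s2 := le_antisymm (fiber_swap hc a b d hab.ne had.ne hbS hdS)
    (fiber_swap hc a d b had.ne hab.ne hdS hbS)
  unfold Third
  rw [e1, card_eq_sum_card_fiberwise (f := fun m => m a) (t := {b, c, d}) (s := Cls m0 L R)]
  · rw [sum_insert, sum_insert, sum_singleton, ← s1, ← s2]
    · ring
    · simp [hcd.ne]
    · simp [hbc.ne, (hbc.trans hcd).ne]
  · intro m hm
    have hm' : m ∈ Cls m0 L R := hm
    have h2 := mem_of_Cls hc hm' a (by rw [hS]; tauto)
    rw [hS] at h2
    have := ((mem_Cls _ _ _ _).1 hm').1.2 a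
    simp
    tauto

lemma closed_step {n : ℕ} {m0 m1 : Equiv.Perm (Fin (2*n))} {L R : Finset (Fin (2*n))}
    (hc : Closed m0 L R) (a b : Fin (2*n)) (hm : m1 ∈ Cls m0 L R) (hb : m1 a = b) :
    Closed m1 ((L.erase a).erase b) ((R.erase a).erase b) := by
  rw [mem_Cls] at hm
  intro i hi hi'
  have h1 := hm.1.1 a
  have h2 := hm.2 i
  have h3 := hc i
  simp only [mem_erase] at *
  by_cases e1 : i = a
  · subst e1; tauto
  by_cases e2 : i = b
  · subst e2; rw [← hb, h1]; tauto
  · rw [h2 (by tauto) (by tauto)]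
    have := h3 (by tauto) (by tauto)
    tauto

lemma third_of_inv {n : ℕ} (k : ℕ) : ∀ (m0 : Equiv.Perm (Fin (2*n))) (L R : Finset (Fin (2*n))),
    L.card + R.card = 2 * k + 4 → StateInv m0 L R → Third (Cls m0 L R) := by
  induction k with
  | zero =>
    intro m0 L R hcard ⟨hlt, hc, h⟩
    rcases h with ⟨h1, h2⟩ | ⟨h1, p, hpL, hpR, hpp, h2⟩
    · have hL : L.card = 2 := by omega
      have hR : R.card = 2 := by omega
      have : ∀ s : Finset (Fin (2*n)), s.card = 2 → ∃ a b, a < b ∧ s = {a, b} := by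
        intro s hs
        obtain ⟨a, b, hab, rfl⟩ := card_eq_two.1 hs
        rcases lt_or_gt_of_ne hab with h | h
        · exact ⟨a, b, h, rfl⟩
        · exact ⟨b, a, h, pair_comm _ _⟩
      obtain ⟨a, b, hab, rfl⟩ := this L hL
      obtain ⟨c, d, hcd, rfl⟩ := this R hR
      refine third_base hc a b c d hab (hlt b (by simp) c (by simp)) hcd ?_ ?_
      · intro i; simp; tauto
      · intro j hj hj'
        obtain ⟨x, hx, hl, hr⟩ := h2 j hj hj'
        exact ⟨x, hx, hl a (by simp), hr c (by simp), Or.inl (hl b (by simp))⟩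
    · have hL : L.card = 1 := by omega
      have hR : R.card = 3 := by omega
      obtain ⟨a, rfl⟩ := card_eq_one.1 hL
      have : ∃ b c d, b < c ∧ c < d ∧ R = {b, c, d} := by
        refine ⟨R.orderEmbOfFin hR 0, R.orderEmbOfFin hR 1, R.orderEmbOfFin hR 2,
          by simp, by simp, ?_⟩
        have := R.range_orderEmbOfFin hR
        ext i
        rw [← mem_coe, ← this]
        rw [Set.mem_range, Fin.exists_fin_succ, Fin.exists_fin_succ, Fin.exists_fin_succ]
        simp only [mem_insert, mem_singleton, eq_comm (a := i)]
        simp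
      obtain ⟨b, c, d, hbc, hcd, rfl⟩ := this
      refine third_base hc a b c d (hlt a (by simp) b (by simp)) hbc hcd ?_ ?_
      · intro i; simp
      · intro j hj hj'
        obtain ⟨x, hx, hl, hr, hpx⟩ := h2 j hj hj'
        exact ⟨x, hx, hl a (by simp), hr c (by simp), Or.inr ⟨p, hpL, hpR, hpp, hpx⟩⟩
  | succ k ih =>
    intro m0 L R hcard ⟨hlt, hc, h⟩
    rcases h with ⟨h1, h2⟩ | ⟨h1, p, hpL, hpR, hpp, h2⟩
    · have hne : L.Nonempty := card_pos.1 (by omega)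
      obtain ⟨a, haL, hmax⟩ : ∃ a ∈ L, ∀ l ∈ L, l ≤ a :=
        ⟨L.max' hne, L.max'_mem hne, fun l hl => L.le_max' l hl⟩
      have haR : a ∉ R := fun h => lt_irrefl _ (hlt a haL a h)
      refine third_step hc a (Or.inl haL) ?_
      intro m1 hm b hba hbS hb
      have hcl := closed_step hc a b hm hb
      rw [mem_Cls] at hm
      have hmb : m1 b = a := by rw [← hb, hm.1.1]
      by_cases hbL : b ∈ L
      · have hbR : b ∉ R := fun h => lt_irrefl _ (hlt b hbL b h)
        have hblt : b < a := lt_of_le_of_ne (hmax b hbL) hba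
        have c1 : ((L.erase a).erase b).card + 2 = L.card := by
          rw [card_erase_of_mem (by simp [hba, hbL]), card_erase_of_mem haL]; omega
        have eR : (R.erase a).erase b = R := by
          rw [erase_eq_of_notMem haR, erase_eq_of_notMem hbR]
        rw [eR] at hcl ⊢
        apply ih
        · omega
        refine ⟨?_, hcl, Or.inr ⟨by omega, a, by simp, haR, by rw [hb]; exact hblt, ?_⟩⟩
        · intro l hl r hr
          simp only [mem_erase] at hl
          exact hlt l hl.2.2 r hr
        · intro j hj hj'
          simp only [mem_erase] at hj
          by_cases hjab : j = a ∨ j = b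
          · refine ⟨a, ?_, ?_, ?_, le_rfl⟩
            · rcases hjab with rfl | rfl
              · simp
              · simp [hmb]
            · intro l hl
              simp only [mem_erase] at hl
              exact lt_of_le_of_ne (hmax l hl.2.2) hl.2.1
            · intro r hr; exact hlt a haL r hr
          · have hjL : j ∉ L := by tauto
            obtain ⟨x, hx, hl, hr⟩ := h2 j hjL hj'
            refine ⟨x, ?_, ?_, hr, (hl a haL).le⟩
            · rwa [hm.2 j hjL hj']
            · intro l hl'
              simp only [mem_erase] at hl'
              exact hl l hl'.2.2
      · have hbR : b ∈ R := by tauto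
        have c1 : ((L.erase a).erase b).card + 1 = L.card := by
          rw [erase_eq_of_notMem (by simp [hbL]), card_erase_of_mem haL]; omega
        have c2 : ((R.erase a).erase b).card + 1 = R.card := by
          rw [erase_eq_of_notMem haR, card_erase_of_mem hbR]; omega
        apply ih
        · omega
        refine ⟨?_, hcl, Or.inl ⟨by omega, ?_⟩⟩
        · intro l hl r hr
          simp only [mem_erase] at hl hr
          exact hlt l hl.2.2 r hr.2.2
        · intro j hj hj'
          simp only [mem_erase] at hj hj'
          by_cases hjab : j = a ∨ j = b
          · refine ⟨a, ?_, ?_, ?_⟩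
            · rcases hjab with rfl | rfl
              · simp
              · simp [hmb]
            · intro l hl
              simp only [mem_erase] at hl
              exact lt_of_le_of_ne (hmax l hl.2.2) hl.2.1
            · intro r hr
              simp only [mem_erase] at hr
              exact hlt a haL r hr.2.2
          · have hjL : j ∉ L := by tauto
            have hjR : j ∉ R := by tauto
            obtain ⟨x, hx, hl, hr⟩ := h2 j hjL hjR
            refine ⟨x, ?_, ?_, ?_⟩
            · rwa [hm.2 j hjL hjR]
            · intro l hl'
              simp only [mem_erase] at hl'
              exact hl l hl'.2.2
            · intro r hr'
              simp only [mem_erase] at hr'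
              exact hr r hr'.2.2
    · have hne : R.Nonempty := card_pos.1 (by omega)
      obtain ⟨a, haR, hmin⟩ : ∃ a ∈ R, ∀ r ∈ R, a ≤ r :=
        ⟨R.min' hne, R.min'_mem hne, fun l hl => R.min'_le l hl⟩
      have haL : a ∉ L := fun h => lt_irrefl _ (hlt a h a haR)
      have hpa : p < a := by
        obtain ⟨x, -, -, hr, hpx⟩ := h2 p hpL hpR
        exact lt_of_le_of_lt hpx (hr a haR)
      refine third_step hc a (Or.inr haR) ?_
      intro m1 hm b hba hbS hb
      have hcl := closed_step hc a b hm hb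
      rw [mem_Cls] at hm
      have hmb : m1 b = a := by rw [← hb, hm.1.1]
      have hcut : ∀ j, j ∉ (L.erase a).erase b → j ∉ (R.erase a).erase b →
          ∃ x, (x = j ∨ x = m1 j) ∧ (∀ l ∈ (L.erase a).erase b, l < x) ∧
            (∀ r ∈ (R.erase a).erase b, x < r) ∧ p ≤ x := by
        intro j hj hj'
        simp only [mem_erase] at hj hj'
        by_cases hjab : j = a ∨ j = b
        · refine ⟨a, ?_, ?_, ?_, hpa.le⟩
          · rcases hjab with rfl | rfl
            · simp
            · simp [hmb]
          · intro l hl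
            simp only [mem_erase] at hl
            exact hlt l hl.2.2 a haR
          · intro r hr
            simp only [mem_erase] at hr
            exact lt_of_le_of_ne (hmin r hr.2.2) (Ne.symm hr.2.1)
        · have hjL : j ∉ L := by tauto
          have hjR : j ∉ R := by tauto
          obtain ⟨x, hx, hl, hr, hpx⟩ := h2 j hjL hjR
          refine ⟨x, ?_, ?_, ?_, hpx⟩
          · rwa [hm.2 j hjL hjR]
          · intro l hl'
            simp only [mem_erase] at hl'
            exact hl l hl'.2.2
          · intro r hr'
            simp only [mem_erase] at hr'
            exact hr r hr'.2.2
      have hlt' : ∀ l ∈ (L.erase a).erase b, ∀ r ∈ (R.erase a).erase b, l < r := by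
        intro l hl r hr
        simp only [mem_erase] at hl hr
        exact hlt l hl.2.2 r hr.2.2
      by_cases hbL : b ∈ L
      · have hbR : b ∉ R := fun h => lt_irrefl _ (hlt b hbL b h)
        have c1 : ((L.erase a).erase b).card + 1 = L.card := by
          rw [erase_eq_of_notMem haL, card_erase_of_mem hbL]
          have := card_pos.2 ⟨b, hbL⟩
          omega
        have c2 : ((R.erase a).erase b).card + 1 = R.card := by
          rw [erase_eq_of_notMem (by simp [hbR]), card_erase_of_mem haR]; omega
        apply ih
        · omega
        refine ⟨hlt', hcl, Or.inr ⟨by omega, p, by simp [hpL], by simp [hpR], ?_, hcut⟩⟩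
        rwa [hm.2 p hpL hpR]
      · have hbR : b ∈ R := by tauto
        have c1 : ((L.erase a).erase b).card = L.card := by
          rw [erase_eq_of_notMem (by simp [hbL]), erase_eq_of_notMem haL]
        have c2 : ((R.erase a).erase b).card + 2 = R.card := by
          rw [card_erase_of_mem (by simp [hba, hbR]), card_erase_of_mem haR]; omega
        apply ih
        · omega
        refine ⟨hlt', hcl, Or.inl ⟨by omega, ?_⟩⟩
        intro j hj hj'
        obtain ⟨x, hx, hl, hr, -⟩ := hcut j hj hj'
        exact ⟨x, hx, hl, hr⟩

lemma rev_mem {n : ℕ} : (Fin.revPerm : Equiv.Perm (Fin (2*n))) ∈ matchings n := by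
  rw [mem_matchings_iff]
  refine ⟨fun i => by simp, fun i h => ?_⟩
  have := congrArg Fin.val h
  simp only [Fin.revPerm_apply, Fin.val_rev] at this
  omega

lemma third_matchings (n : ℕ) (hn : 2 ≤ n) : Third (matchings n) := by
  let L : Finset (Fin (2*n)) := univ.filter (fun i => i.val < n)
  let R : Finset (Fin (2*n)) := univ.filter (fun i => ¬ i.val < n)
  have hL : L.card = n := by
    have h : L = (univ : Finset (Fin n)).map (Fin.castLEEmb (by omega : n ≤ 2*n)) := by
      ext i
      simp only [L, mem_filter, mem_univ, true_and, mem_map, Fin.castLEEmb_apply]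
      constructor
      · intro h; exact ⟨⟨i, h⟩, rfl⟩
      · rintro ⟨j, rfl⟩; simp
    rw [h]; simp
  have hLR : L.card + R.card = 2 * n := by
    have := card_filter_add_card_filter_not (s := (univ : Finset (Fin (2*n)))) (fun i => i.val < n)
    rw [card_univ, Fintype.card_fin] at this
    exact this
  have hmem : ∀ i, i ∉ L → i ∉ R → False := by
    intro i h h'
    simp only [L, R, mem_filter, mem_univ, true_and] at h h'
    exact h' h
  have e : matchings n = Cls Fin.revPerm L R := by
    ext m
    simp only [Cls, mem_filter]
    exact ⟨fun h => ⟨h, fun i h h' => (hmem i h h').elim⟩, fun h => h.1⟩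
  rw [e]
  refine third_of_inv (n - 2) _ L R (by omega) ⟨?_, fun i h h' => (hmem i h h').elim,
    Or.inl ⟨by omega, fun i h h' => (hmem i h h').elim⟩⟩
  intro l hl r hr
  simp only [L, R, mem_filter, mem_univ, true_and] at hl hr
  rw [Fin.lt_def]
  omega

/-- For a uniformly random perfect matching of `{1, …, 2n}` (`n ≥ 2`), the
probability that some interval intersects all of the other `n−1` intervals is
exactly `2/3`. -/
theorem prob_max_degree_full (n : ℕ) (hn : 2 ≤ n) :
    (((matchings n).filter meetsAll).card : ℚ) / ((matchings n).card : ℚ)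
      = 2/3 := by
  have h := third_matchings n hn
  unfold Third at h
  have h2 := card_filter_add_card_filter_not (s := matchings n) meetsAll
  have h3 : 0 < (matchings n).card := card_pos.2 ⟨_, rev_mem⟩
  have h4 : (3 : ℚ) * ((matchings n).filter meetsAll).card = 2 * (matchings n).card := by
    exact_mod_cast (by omega)
  have h5 : ((matchings n).card : ℚ) ≠ 0 := by positivity
  rw [div_eq_div_iff h5 (by norm_num)]
  linarith
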